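/- Global gradient bound under supercritical phase (Proposition 4.5): Let n ≥ 3 be an integer, a > 1, and let σ : [1,a] → ℝ be smooth with σ ≥ 0, σ(1) = σ(a) = 0. Let f : [0,T) × [1,a] → ℝ be a smooth solution of ∂_t f = σ(x)·( (∂_xx f)/(1 + (∂_x f)²) + (n−1)·(x·∂_x f − f)/(x² + f²) ) with fixed boundary values f(t,1) = q, f(t,a) = p, and suppose the initial data has supercritical phase: (n−1)·arctan(f(0,x)/x) + arctan(∂_x f(0,x)) > (n−2)·π/2 for all x ∈ [1,a]. Then there exist constants A, B > 0 (independent of t and T) such that sup_{x∈[1,a]} |∂_x f(t,x)| ≤ A·(1+t)·e^{B·t} for all t ∈ [0,T). In particular the first derivative of f remains bounded for all finite times. -/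

import Mathlib

open Real Set

/-- The right-hand side of the reduced line bundle mean curvature flow under Calabi symmetry. -/
noncomputable def flowRHS (n : ℕ) (a : ℝ) (σ : ℝ → ℝ) (f : ℝ → ℝ → ℝ) (t x : ℝ) : ℝ :=
  σ x * (derivWithin (derivWithin (f t) (Icc 1 a)) (Icc 1 a) x /
      (1 + (derivWithin (f t) (Icc 1 a) x) ^ 2) +
    ((n : ℝ) - 1) * (x * derivWithin (f t) (Icc 1 a) x - f t x) / (x ^ 2 + (f t x) ^ 2))

/-- First-order condition at a maximum point over a convex set of reals. -/
lemma mul_sub_nonpos_of_isMaxOn {s : Set ℝ} (hs : Convex ℝ s) {v : ℝ → ℝ} {d x y : ℝ}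
    (hx : x ∈ s) (hy : y ∈ s) (hmax : IsMaxOn v s x) (hv : HasDerivWithinAt v d s x) :
    d * (y - x) ≤ 0 := by
  have h := hmax.localize.hasFDerivWithinAt_nonpos hv.hasFDerivWithinAt
    (sub_mem_posTangentConeAt_of_segment_subset (hs.segment_subset hx hy))
  simpa [mul_comm] using h

/-- Second-order condition at an interior maximum point. -/
lemma second_deriv_nonpos_of_isMaxOn_Icc {l r : ℝ} {v v' : ℝ → ℝ} {v'' x : ℝ}
    (hx : x ∈ Ioo l r) (hv : ∀ y ∈ Icc l r, HasDerivWithinAt v (v' y) (Icc l r) y)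
    (hv' : HasDerivWithinAt v' v'' (Icc l r) x) (hmax : IsMaxOn v (Icc l r) x) : v'' ≤ 0 := by
  by_contra! hpos
  have hnhds : ∀ y ∈ Ioo l r, Icc l r ∈ nhds y := fun y hy => Icc_mem_nhds hy.1 hy.2
  have hev : deriv v =ᶠ[nhds x] v' := by
    filter_upwards [isOpen_Ioo.mem_nhds hx] with y hy
    exact ((hv y (Ioo_subset_Icc_self hy)).hasDerivAt (hnhds y hy)).deriv
  have hlmax : IsLocalMax v x := hmax.isLocalMax (hnhds x hx)
  have hdd : HasDerivAt (deriv v) v'' x :=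
    (hv'.hasDerivAt (hnhds x hx)).congr_of_eventuallyEq hev
  have hlmin : IsLocalMin v x := isLocalMin_of_deriv_deriv_pos (by rwa [hdd.deriv])
    hlmax.deriv_eq_zero
    ((hv x (Ioo_subset_Icc_self hx)).hasDerivAt (hnhds x hx)).continuousAt
  have hconst : v =ᶠ[nhds x] fun _ => v x := by
    filter_upwards [hlmax, hlmin] with y h1 h2 using le_antisymm h1 h2
  have hz : HasDerivAt (deriv v) 0 x := by
    have h := hconst.deriv
    exact ((hasDerivAt_const x (0 : ℝ)).congr_of_eventuallyEq (by simpa using h))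
  exact hpos.ne' (hdd.unique hz)

/-- Conditions at a spatial maximum, weighted by a nonnegative function vanishing at the
endpoints. -/
lemma weighted_conditions_of_isMaxOn {l r : ℝ} (hlr : l < r) {σ v v' : ℝ → ℝ} {σ' v'' x : ℝ}
    (hσ0 : ∀ y ∈ Icc l r, 0 ≤ σ y) (hσl : σ l = 0) (hσr : σ r = 0) (hx : x ∈ Icc l r)
    (hσ : HasDerivWithinAt σ σ' (Icc l r) x)
    (hv : ∀ y ∈ Icc l r, HasDerivWithinAt v (v' y) (Icc l r) y)
    (hv' : HasDerivWithinAt v' v'' (Icc l r) x) (hmax : IsMaxOn v (Icc l r) x) :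
    σ x * v' x = 0 ∧ σ x * v'' ≤ 0 ∧ σ' * v' x ≤ 0 := by
  have hl : l ∈ Icc l r := left_mem_Icc.2 hlr.le
  have hr : r ∈ Icc l r := right_mem_Icc.2 hlr.le
  have hvl := mul_sub_nonpos_of_isMaxOn (convex_Icc l r) hx hl hmax (hv x hx)
  have hvr := mul_sub_nonpos_of_isMaxOn (convex_Icc l r) hx hr hmax (hv x hx)
  have hσmax : σ x = 0 → ∀ y ∈ Icc l r, -σ' * (y - x) ≤ 0 := fun h y hy =>
    mul_sub_nonpos_of_isMaxOn (convex_Icc l r) hx hy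
      (fun z hz => by simpa [h] using hσ0 z hz) hσ.neg
  rcases hx.1.eq_or_lt with rfl | hlx
  · have h := hσmax hσl r hr
    refine ⟨by simp [hσl], by simp [hσl], ?_⟩
    have h1 : v' l ≤ 0 := by nlinarith
    have h2 : 0 ≤ σ' := by nlinarith
    exact mul_nonpos_of_nonneg_of_nonpos h2 h1
  rcases hx.2.eq_or_lt with rfl | hxr
  · have h := hσmax hσr l hl
    refine ⟨by simp [hσr], by simp [hσr], ?_⟩
    have h1 : 0 ≤ v' x := by nlinarith
    have h2 : σ' ≤ 0 := by nlinarith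
    exact mul_nonpos_of_nonpos_of_nonneg h2 h1
  have hz : v' x = 0 := by
    apply le_antisymm <;> nlinarith
  have h2 := second_deriv_nonpos_of_isMaxOn_Icc ⟨hlx, hxr⟩ hv hv' hmax
  exact ⟨by simp [hz], mul_nonpos_of_nonneg_of_nonpos (hσ0 x hx) h2, by simp [hz]⟩

/-- Parabolic maximum principle: a function that is initially nonpositive and strictly
decreasing in time at its positive spatial maxima stays nonpositive. -/
lemma nonpos_of_deriv_neg_at_spatial_max {T l r : ℝ} {u u' : ℝ × ℝ → ℝ}
    (hcont : ContinuousOn u (Ico 0 T ×ˢ Icc l r))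
    (hderiv : ∀ t ∈ Ico 0 T, ∀ x ∈ Icc l r,
      HasDerivWithinAt (fun s => u (s, x)) (u' (t, x)) (Ico 0 T) t)
    (hinit : ∀ x ∈ Icc l r, u (0, x) ≤ 0)
    (hmax : ∀ t ∈ Ico 0 T, ∀ x ∈ Icc l r, 0 < u (t, x) →
      IsMaxOn (fun y => u (t, y)) (Icc l r) x → u' (t, x) < 0) :
    ∀ t ∈ Ico 0 T, ∀ x ∈ Icc l r, u (t, x) ≤ 0 := by
  intro t₁ ht₁ x₁ hx₁
  by_contra! hpos
  have hsub : Icc 0 t₁ ⊆ Ico 0 T := fun s hs => ⟨hs.1, hs.2.trans_lt ht₁.2⟩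
  obtain ⟨⟨t, x⟩, ⟨ht, hx⟩, hm⟩ := (isCompact_Icc.prod isCompact_Icc).exists_isMaxOn
    ⟨(t₁, x₁), ⟨⟨ht₁.1, le_rfl⟩, hx₁⟩⟩ (hcont.mono (prod_mono hsub (Subset.refl (Icc l r))))
  have hux : 0 < u (t, x) := hpos.trans_le (hm ⟨⟨ht₁.1, le_rfl⟩, hx₁⟩)
  have hneg := hmax t (hsub ht) x hx hux fun y hy => hm ⟨ht, hy⟩
  have ht0 : 0 < t := by
    rcases ht.1.eq_or_lt with rfl | h
    · exact absurd (hinit x hx) hux.not_ge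
    · exact h
  have hsub' : Icc 0 t ⊆ Icc 0 t₁ := Icc_subset_Icc_right ht.2
  have hd := mul_sub_nonpos_of_isMaxOn (convex_Icc 0 t) (right_mem_Icc.2 ht0.le)
    (left_mem_Icc.2 ht0.le) (v := fun s => u (s, x)) (fun s hs => hm ⟨hsub' hs, hx⟩)
    ((hderiv t (hsub ht) x hx).mono (hsub'.trans hsub))
  nlinarith

/-- Slice derivative in the second variable. -/
lemma hasDerivWithinAt_slice_snd {F : ℝ × ℝ → ℝ} {I J : Set ℝ} {t x : ℝ} (ht : t ∈ I)
    (hF : DifferentiableWithinAt ℝ F (I ×ˢ J) (t, x)) :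
    HasDerivWithinAt (fun y => F (t, y)) (fderivWithin ℝ F (I ×ˢ J) (t, x) (0, 1)) J x :=
  hF.hasFDerivWithinAt.comp_hasDerivWithinAt (f := fun y => (t, y)) x
    ((hasDerivWithinAt_const x J t).prodMk (hasDerivWithinAt_id x J)) fun _ hy => ⟨ht, hy⟩

/-- Slice derivative in the first variable. -/
lemma hasDerivWithinAt_slice_fst {F : ℝ × ℝ → ℝ} {I J : Set ℝ} {t x : ℝ} (hx : x ∈ J)
    (hF : DifferentiableWithinAt ℝ F (I ×ˢ J) (t, x)) :
    HasDerivWithinAt (fun s => F (s, x)) (fderivWithin ℝ F (I ×ˢ J) (t, x) (1, 0)) I t :=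
  hF.hasFDerivWithinAt.comp_hasDerivWithinAt (f := fun s => (s, x)) t
    ((hasDerivWithinAt_id t I).prodMk (hasDerivWithinAt_const t I x)) fun _ hy => ⟨hy, hx⟩

/-- Equality of mixed second derivatives, up to the boundary. -/
lemma fderivWithin_fderivWithin_comm {E : Type*} [NormedAddCommGroup E] [NormedSpace ℝ E]
    {F : E → ℝ} {S : Set E} (hS : UniqueDiffOn ℝ S) (hcl : S ⊆ closure (interior S))
    (hF : ContDiffOn ℝ (⊤ : ℕ∞) F S) {z : E} (hz : z ∈ S) (v w : E) :
    fderivWithin ℝ (fun p => fderivWithin ℝ F S p v) S z w =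
      fderivWithin ℝ (fun p => fderivWithin ℝ F S p w) S z v := by
  have hD : DifferentiableWithinAt ℝ (fderivWithin ℝ F S) S z :=
    (hF.fderivWithin (m := (⊤ : ℕ∞)) hS (by simp)).differentiableOn (by simp) z hz
  have key : ∀ v w : E, fderivWithin ℝ (fun p => fderivWithin ℝ F S p v) S z w =
      fderivWithin ℝ (fderivWithin ℝ F S) S z w v := by
    intro v w
    have h := (hD.hasFDerivWithinAt.clm_apply (hasFDerivWithinAt_const v z S)).fderivWithin
      (hS z hz)
    rw [h]; simp
  rw [key, key]
  exact (hF z hz).isSymmSndFDerivWithinAt (by simp; norm_cast) hS (hcl hz) hz w v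

/-- A directional derivative of a smooth function is smooth. -/
lemma contDiffOn_directional_fderivWithin {E : Type*} [NormedAddCommGroup E] [NormedSpace ℝ E]
    {F : E → ℝ} {S : Set E} (hS : UniqueDiffOn ℝ S) (hF : ContDiffOn ℝ (⊤ : ℕ∞) F S) (v : E) :
    ContDiffOn ℝ (⊤ : ℕ∞) (fun p => fderivWithin ℝ F S p v) S :=
  (hF.fderivWithin hS (by simp)).clm_apply contDiffOn_const

lemma uniqueDiffOn_Ico_prod_Icc (T : ℝ) {l r : ℝ} (hlr : l < r) :
    UniqueDiffOn ℝ (Ico 0 T ×ˢ Icc l r) :=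
  (uniqueDiffOn_Ico 0 T).prod (uniqueDiffOn_Icc hlr)

lemma Ico_prod_Icc_subset_closure_interior (T : ℝ) {l r : ℝ} (hlr : l < r) :
    Ico 0 T ×ˢ Icc l r ⊆ closure (interior (Ico 0 T ×ˢ Icc l r)) := by
  rintro ⟨t, x⟩ ⟨ht, hx⟩
  have hT : (0 : ℝ) ≠ T := (ht.1.trans_lt ht.2).ne
  rw [interior_prod_eq, closure_prod_eq, interior_Ico, interior_Icc, closure_Ioo hT,
    closure_Ioo hlr.ne]
  exact ⟨Ico_subset_Icc_self ht, hx⟩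

/-- The reduced Lagrangian angle, with `c` in place of `n - 1`. -/
noncomputable def lagrangianAngle (c : ℝ) (F : ℝ × ℝ → ℝ) (S : Set (ℝ × ℝ)) (p : ℝ × ℝ) : ℝ :=
  c * arctan (F p / p.2) + arctan (fderivWithin ℝ F S p (0, 1))

lemma contDiffOn_lagrangianAngle (c : ℝ) {F : ℝ × ℝ → ℝ} {S : Set (ℝ × ℝ)}
    (hS : UniqueDiffOn ℝ S) (hpos : ∀ p ∈ S, p.2 ≠ 0) (hF : ContDiffOn ℝ (⊤ : ℕ∞) F S) :
    ContDiffOn ℝ (⊤ : ℕ∞) (lagrangianAngle c F S) S :=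
  (contDiffOn_const.mul ((hF.div contDiffOn_snd hpos).arctan)).add
    (contDiffOn_directional_fderivWithin hS hF _).arctan

/-- The angle flow equation is `∂ₜ F = σ ∂ₓ Θ`; this is the resulting equation for `∂ₓ F`. -/
lemma fderivWithin_gradient_time {c T l r : ℝ} (hlr : l < r) {F : ℝ × ℝ → ℝ} {σ : ℝ → ℝ}
    (hl : 0 < l) (hF : ContDiffOn ℝ (⊤ : ℕ∞) F (Ico 0 T ×ˢ Icc l r))
    (hpde : ∀ p ∈ Ico 0 T ×ˢ Icc l r, fderivWithin ℝ F (Ico 0 T ×ˢ Icc l r) p (1, 0) =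
      σ p.2 * fderivWithin ℝ (lagrangianAngle c F (Ico 0 T ×ˢ Icc l r))
        (Ico 0 T ×ˢ Icc l r) p (0, 1))
    {t x σ' : ℝ} (ht : t ∈ Ico 0 T) (hx : x ∈ Icc l r)
    (hσ : HasDerivWithinAt σ σ' (Icc l r) x) :
    fderivWithin ℝ (fun p => fderivWithin ℝ F (Ico 0 T ×ˢ Icc l r) p (0, 1))
        (Ico 0 T ×ˢ Icc l r) (t, x) (1, 0) =
      σ' * fderivWithin ℝ (lagrangianAngle c F (Ico 0 T ×ˢ Icc l r))
        (Ico 0 T ×ˢ Icc l r) (t, x) (0, 1) +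
      σ x * fderivWithin ℝ (fun p => fderivWithin ℝ (lagrangianAngle c F (Ico 0 T ×ˢ Icc l r))
        (Ico 0 T ×ˢ Icc l r) p (0, 1)) (Ico 0 T ×ˢ Icc l r) (t, x) (0, 1) := by
  have hS := uniqueDiffOn_Ico_prod_Icc T hlr
  have hcl := Ico_prod_Icc_subset_closure_interior T hlr
  set S := Ico 0 T ×ˢ Icc l r with hSdef
  have hΘ := contDiffOn_lagrangianAngle c hS (fun p hp => (hl.trans_le hp.2.1).ne') hF
  have hz : (t, x) ∈ S := ⟨ht, hx⟩
  rw [fderivWithin_fderivWithin_comm hS hcl hF hz]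
  have h1 := hasDerivWithinAt_slice_snd ht
    ((contDiffOn_directional_fderivWithin hS hF (1, 0)).differentiableOn (by simp) _ hz)
  have h2 := hσ.mul (hasDerivWithinAt_slice_snd ht
    ((contDiffOn_directional_fderivWithin hS hΘ (0, 1)).differentiableOn (by simp) _ hz))
  exact (uniqueDiffOn_Icc hlr x hx).eq_deriv _ h1
    (h2.congr (fun y hy => hpde (t, y) ⟨ht, hy⟩) (hpde (t, x) hz))

/-- The minimum of the Lagrangian angle does not decrease along the flow. -/
lemma le_lagrangianAngle_of_initial {c m T l r : ℝ} (hlr : l < r) (hl : 0 < l)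
    {F : ℝ × ℝ → ℝ} {σ σ' : ℝ → ℝ}
    (hσ : ∀ x ∈ Icc l r, HasDerivWithinAt σ (σ' x) (Icc l r) x)
    (hσ0 : ∀ x ∈ Icc l r, 0 ≤ σ x) (hσl : σ l = 0) (hσr : σ r = 0)
    (hF : ContDiffOn ℝ (⊤ : ℕ∞) F (Ico 0 T ×ˢ Icc l r))
    (hpde : ∀ p ∈ Ico 0 T ×ˢ Icc l r, fderivWithin ℝ F (Ico 0 T ×ˢ Icc l r) p (1, 0) =
      σ p.2 * fderivWithin ℝ (lagrangianAngle c F (Ico 0 T ×ˢ Icc l r))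
        (Ico 0 T ×ˢ Icc l r) p (0, 1))
    (hinit : ∀ x ∈ Icc l r, m ≤ lagrangianAngle c F (Ico 0 T ×ˢ Icc l r) (0, x)) :
    ∀ t ∈ Ico 0 T, ∀ x ∈ Icc l r, m ≤ lagrangianAngle c F (Ico 0 T ×ˢ Icc l r) (t, x) := by
  have hgrad := fun t ht x hx =>
    fderivWithin_gradient_time hlr hl hF hpde (t := t) ht (x := x) hx (hσ x hx)
  have hS := uniqueDiffOn_Ico_prod_Icc T hlr
  set S := Ico 0 T ×ˢ Icc l r with hSdef
  set Θ := lagrangianAngle c F S with hΘdef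
  have hΘ : ContDiffOn ℝ (⊤ : ℕ∞) Θ S :=
    contDiffOn_lagrangianAngle c hS (fun p hp => (hl.trans_le hp.2.1).ne') hF
  have hΘ1 := contDiffOn_directional_fderivWithin hS hΘ (0, 1)
  have hW := contDiffOn_directional_fderivWithin hS hF (0, 1)
  have hΘt : ∀ t ∈ Ico 0 T, ∀ x ∈ Icc l r, fderivWithin ℝ Θ S (t, x) (1, 0) =
      c * (1 / (1 + (F (t, x) / x) ^ 2) * (fderivWithin ℝ F S (t, x) (1, 0) / x)) +
      1 / (1 + (fderivWithin ℝ F S (t, x) (0, 1)) ^ 2) *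
        fderivWithin ℝ (fun p => fderivWithin ℝ F S p (0, 1)) S (t, x) (1, 0) := by
    intro t ht x hx
    have hz : (t, x) ∈ S := ⟨ht, hx⟩
    refine (uniqueDiffOn_Ico 0 T t ht).eq_deriv _
      (hasDerivWithinAt_slice_fst hx (hΘ.differentiableOn (by simp) _ hz)) ?_
    exact ((((hasDerivWithinAt_slice_fst hx
      (hF.differentiableOn (by simp) _ hz)).div_const x).arctan).const_mul c).add
      (hasDerivWithinAt_slice_fst hx (hW.differentiableOn (by simp) _ hz)).arctan
  intro t ht x hx
  have main : ∀ ε > 0, m - Θ (t, x) - ε * t ≤ 0 := by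
    intro ε hε
    refine nonpos_of_deriv_neg_at_spatial_max (T := T) (l := l) (r := r)
      (u := fun p => m - Θ p - ε * p.1)
      (u' := fun p => -fderivWithin ℝ Θ S p (1, 0) - ε) ?_ ?_ ?_ ?_ t ht x hx
    · exact (continuousOn_const.sub hΘ.continuousOn).sub (by fun_prop)
    · intro t ht x hx
      have h := ((hasDerivWithinAt_slice_fst hx
        (hΘ.differentiableOn (by simp) (t, x) ⟨ht, hx⟩)).const_sub m).sub
        ((hasDerivWithinAt_id t (Ico 0 T)).const_mul ε)
      exact h.congr_deriv (by rw [mul_one])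
    · intro x hx
      simpa using hinit x hx
    · intro t ht x hx _ hmax
      have hz : (t, x) ∈ S := ⟨ht, hx⟩
      obtain ⟨h1, h2, h3⟩ := weighted_conditions_of_isMaxOn hlr hσ0 hσl hσr hx (hσ x hx)
        (v := fun y => -Θ (t, y)) (v' := fun y => -fderivWithin ℝ Θ S (t, y) (0, 1))
        (fun y hy => (hasDerivWithinAt_slice_snd ht
          (hΘ.differentiableOn (by simp) (t, y) ⟨ht, hy⟩)).neg)
        (hasDerivWithinAt_slice_snd ht (hΘ1.differentiableOn (by simp) _ hz)).neg
        (isMaxOn_iff.2 fun y hy => by linarith [isMaxOn_iff.1 hmax y hy])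
      have hge : 0 ≤ fderivWithin ℝ Θ S (t, x) (1, 0) := by
        rw [hΘt t ht x hx, hpde _ hz, hgrad t ht x hx]
        have h4 : σ x * fderivWithin ℝ Θ S (t, x) (0, 1) = 0 := by linarith
        rw [h4, zero_div, mul_zero, mul_zero, zero_add]
        exact mul_nonneg (by positivity) (by linarith)
      linarith
  have hlim : ∀ ε > 0, m ≤ Θ (t, x) + ε := by
    intro ε hε
    have h := main (ε / (1 + t)) (div_pos hε (by linarith [ht.1]))
    have h2 : ε / (1 + t) * t ≤ ε := by
      rw [div_mul_eq_mul_div, div_le_iff₀ (by linarith [ht.1])]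
      nlinarith [ht.1]
    linarith
  exact le_of_forall_pos_le_add hlim

/-- Algebraic estimate for the evolution of the gradient `w` at a spatial maximum. -/
lemma gradient_evolution_le {c x F w s s' q r K₁ K₂ : ℝ} (hc : 0 ≤ c) (hx : 1 ≤ x) (hF : 0 ≤ F)
    (hw : 0 ≤ w) (hs : 0 ≤ s) (hsK : s ≤ K₂) (hsK' : |s'| ≤ K₁)
    (hsq : s * q = 0) (hsr : s * r ≤ 0) (hsq' : s' * q ≤ 0) :
    s' * (q / (1 + w ^ 2) + c * (x * w - F) / (x ^ 2 + F ^ 2)) +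
      s * ((r * (1 + w ^ 2) - q * (2 * w * q)) / (1 + w ^ 2) ^ 2 +
        (c * (w + x * q - w) * (x ^ 2 + F ^ 2) - c * (x * w - F) * (2 * x + 2 * F * w)) /
          (x ^ 2 + F ^ 2) ^ 2) ≤ c * (K₁ + 2 * K₂) * (1 + w) := by
  have hP : 1 ≤ x ^ 2 + F ^ 2 := by nlinarith
  have hP0 : 0 < x ^ 2 + F ^ 2 := by linarith
  have hxP : x ≤ x ^ 2 + F ^ 2 := by nlinarith
  have hFP : F ≤ x ^ 2 + F ^ 2 := by nlinarith
  have hA : |(x * w - F) / (x ^ 2 + F ^ 2)| ≤ 1 + w := by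
    rw [abs_le]
    constructor
    · rw [le_div_iff₀ hP0]; nlinarith
    · rw [div_le_iff₀ hP0]; nlinarith
  have hB : -((x * w - F) * (2 * x + 2 * F * w)) / (x ^ 2 + F ^ 2) ^ 2 ≤ 2 * (1 + w) := by
    rw [div_le_iff₀ (by positivity)]
    have e1 : -((x * w - F) * (2 * x + 2 * F * w)) ≤ 2 * (1 + w) * (x ^ 2 + F ^ 2) := by
      have : 0 ≤ x * F * w ^ 2 := by positivity
      nlinarith [sq_nonneg (x - F), mul_nonneg hw (sq_nonneg x), sq_nonneg x, sq_nonneg F]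
    have e2 : x ^ 2 + F ^ 2 ≤ (x ^ 2 + F ^ 2) ^ 2 := by nlinarith
    exact e1.trans (mul_le_mul_of_nonneg_left e2 (by positivity))
  have h1 : s' * ((x * w - F) / (x ^ 2 + F ^ 2)) ≤ K₁ * (1 + w) :=
    (le_abs_self _).trans (by
      rw [abs_mul]
      exact mul_le_mul hsK' hA (abs_nonneg _) ((abs_nonneg _).trans hsK'))
  have h2 : s * (-((x * w - F) * (2 * x + 2 * F * w)) / (x ^ 2 + F ^ 2) ^ 2) ≤
      K₂ * (2 * (1 + w)) :=
    (mul_le_mul_of_nonneg_left hB hs).trans (mul_le_mul_of_nonneg_right hsK (by positivity))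
  have h3 : s' * q / (1 + w ^ 2) ≤ 0 := div_nonpos_of_nonpos_of_nonneg hsq' (by positivity)
  have h4 : s * r / (1 + w ^ 2) ≤ 0 := div_nonpos_of_nonpos_of_nonneg hsr (by positivity)
  have hsplit : s' * (q / (1 + w ^ 2) + c * (x * w - F) / (x ^ 2 + F ^ 2)) +
      s * ((r * (1 + w ^ 2) - q * (2 * w * q)) / (1 + w ^ 2) ^ 2 +
        (c * (w + x * q - w) * (x ^ 2 + F ^ 2) - c * (x * w - F) * (2 * x + 2 * F * w)) /
          (x ^ 2 + F ^ 2) ^ 2) =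
      s' * q / (1 + w ^ 2) + s * r / (1 + w ^ 2) +
      s * q * (c * x / (x ^ 2 + F ^ 2) - 2 * w * q / (1 + w ^ 2) ^ 2) +
      c * (s' * ((x * w - F) / (x ^ 2 + F ^ 2)) +
        s * (-((x * w - F) * (2 * x + 2 * F * w)) / (x ^ 2 + F ^ 2) ^ 2)) := by
    have : (1 + w ^ 2) ≠ 0 := by positivity
    field_simp
    ring
  rw [hsplit, hsq, zero_mul]
  nlinarith [mul_le_mul_of_nonneg_left (add_le_add h1 h2) hc]

/-- Spatial derivative of the Lagrangian angle. -/
lemma fderivWithin_lagrangianAngle_space {c T l r : ℝ} (hlr : l < r) (hl : 0 < l)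
    {F : ℝ × ℝ → ℝ} (hF : ContDiffOn ℝ (⊤ : ℕ∞) F (Ico 0 T ×ˢ Icc l r))
    {t x : ℝ} (ht : t ∈ Ico 0 T) (hx : x ∈ Icc l r) :
    fderivWithin ℝ (lagrangianAngle c F (Ico 0 T ×ˢ Icc l r)) (Ico 0 T ×ˢ Icc l r) (t, x) (0, 1) =
      fderivWithin ℝ (fun p => fderivWithin ℝ F (Ico 0 T ×ˢ Icc l r) p (0, 1))
          (Ico 0 T ×ˢ Icc l r) (t, x) (0, 1) /
        (1 + (fderivWithin ℝ F (Ico 0 T ×ˢ Icc l r) (t, x) (0, 1)) ^ 2) +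
      c * (x * fderivWithin ℝ F (Ico 0 T ×ˢ Icc l r) (t, x) (0, 1) - F (t, x)) /
        (x ^ 2 + F (t, x) ^ 2) := by
  have hS := uniqueDiffOn_Ico_prod_Icc T hlr
  set S := Ico 0 T ×ˢ Icc l r with hSdef
  have hz : (t, x) ∈ S := ⟨ht, hx⟩
  have hx0 : 0 < x := hl.trans_le hx.1
  have hΘ := contDiffOn_lagrangianAngle c hS (fun p hp => (hl.trans_le hp.2.1).ne') hF
  have hW := contDiffOn_directional_fderivWithin hS hF (0, 1)
  have h1 := hasDerivWithinAt_slice_snd ht (hΘ.differentiableOn (by simp) _ hz)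
  have h2 := ((((hasDerivWithinAt_slice_snd ht (hF.differentiableOn (by simp) _ hz)).div
    (hasDerivWithinAt_id x (Icc l r)) hx0.ne').arctan).const_mul c).add
    (hasDerivWithinAt_slice_snd ht (hW.differentiableOn (by simp) _ hz)).arctan
  rw [(uniqueDiffOn_Icc hlr x hx).eq_deriv _ h1 h2]
  simp only [id_eq, Pi.div_apply, ← hSdef]
  have hP : x ^ 2 + F (t, x) ^ 2 ≠ 0 := by positivity
  have hQ : 1 + (fderivWithin ℝ F S (t, x) (0, 1)) ^ 2 ≠ 0 := by positivity
  have hR : 1 + (F (t, x) / x) ^ 2 ≠ 0 := by positivity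
  field_simp
  ring

/-- Exponential upper bound for the gradient of a nonnegative solution. -/
lemma gradient_le_of_initial {c T r K₁ K₂ M B : ℝ} (hc : 0 ≤ c) (hr : 1 < r)
    {F : ℝ × ℝ → ℝ} {σ σ' : ℝ → ℝ}
    (hσ : ∀ x ∈ Icc 1 r, HasDerivWithinAt σ (σ' x) (Icc 1 r) x)
    (hσ0 : ∀ x ∈ Icc 1 r, 0 ≤ σ x) (hσl : σ 1 = 0) (hσr : σ r = 0)
    (hK₁ : ∀ x ∈ Icc 1 r, |σ' x| ≤ K₁) (hK₂ : ∀ x ∈ Icc 1 r, σ x ≤ K₂)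
    (hF : ContDiffOn ℝ (⊤ : ℕ∞) F (Ico 0 T ×ˢ Icc 1 r))
    (hpde : ∀ p ∈ Ico 0 T ×ˢ Icc 1 r, fderivWithin ℝ F (Ico 0 T ×ˢ Icc 1 r) p (1, 0) =
      σ p.2 * fderivWithin ℝ (lagrangianAngle c F (Ico 0 T ×ˢ Icc 1 r))
        (Ico 0 T ×ˢ Icc 1 r) p (0, 1))
    (hF0 : ∀ p ∈ Ico 0 T ×ˢ Icc 1 r, 0 ≤ F p) (hM : 1 ≤ M) (hB : 0 ≤ B)
    (hBK : c * (K₁ + 2 * K₂) < B)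
    (hinit : ∀ x ∈ Icc 1 r, 1 + fderivWithin ℝ F (Ico 0 T ×ˢ Icc 1 r) (0, x) (0, 1) ≤ M) :
    ∀ t ∈ Ico 0 T, ∀ x ∈ Icc 1 r,
      1 + fderivWithin ℝ F (Ico 0 T ×ˢ Icc 1 r) (t, x) (0, 1) ≤ M * exp (B * t) := by
  have hgrad := fun t ht x hx =>
    fderivWithin_gradient_time hr one_pos hF hpde (t := t) ht (x := x) hx (hσ x hx)
  have hspace := fun t ht x hx =>
    fderivWithin_lagrangianAngle_space (c := c) hr one_pos hF (t := t) ht (x := x) hx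
  have hS := uniqueDiffOn_Ico_prod_Icc T hr
  set S := Ico 0 T ×ˢ Icc 1 r with hSdef
  set Θ := lagrangianAngle c F S with hΘdef
  have hΘ : ContDiffOn ℝ (⊤ : ℕ∞) Θ S :=
    contDiffOn_lagrangianAngle c hS (fun p hp => (one_pos.trans_le hp.2.1).ne') hF
  have hΘ1 := contDiffOn_directional_fderivWithin hS hΘ (0, 1)
  have hW := contDiffOn_directional_fderivWithin hS hF (0, 1)
  set W : ℝ × ℝ → ℝ := fun p => fderivWithin ℝ F S p (0, 1) with hWdef
  have hW1 := contDiffOn_directional_fderivWithin hS hW (0, 1)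
  have hmain : ∀ t ∈ Ico 0 T, ∀ x ∈ Icc 1 r, exp (-(B * t)) * (1 + W (t, x)) - M ≤ 0 := by
    refine nonpos_of_deriv_neg_at_spatial_max (T := T) (l := 1) (r := r)
      (u := fun p => exp (-(B * p.1)) * (1 + W p) - M)
      (u' := fun p => exp (-(B * p.1)) * (fderivWithin ℝ W S p (1, 0) - B * (1 + W p)))
      ?_ ?_ ?_ ?_
    · exact ((by fun_prop : Continuous fun p : ℝ × ℝ => exp (-(B * p.1))).continuousOn.mul
        (continuousOn_const.add hW.continuousOn)).sub continuousOn_const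
    · intro t ht x hx
      have h1 := (((hasDerivWithinAt_id t (Ico 0 T)).const_mul B).neg).exp
      have h2 := (hasDerivWithinAt_slice_fst hx
        (hW.differentiableOn (by simp) (t, x) ⟨ht, hx⟩)).const_add 1
      refine ((h1.mul h2).sub_const M).congr_deriv ?_
      simp only [id_eq, Pi.neg_apply, ← hSdef]
      ring
    · intro x hx
      simpa using hinit x hx
    · intro t ht x hx hpos hmax
      have hz : (t, x) ∈ S := ⟨ht, hx⟩
      have hWpos : 0 ≤ W (t, x) := by
        have h1 : exp (-(B * t)) ≤ 1 := exp_le_one_iff.2 (by nlinarith [mul_nonneg hB ht.1])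
        by_contra! hneg
        have h2 : exp (-(B * t)) * W (t, x) < 0 := mul_neg_of_pos_of_neg (exp_pos _) hneg
        simp only at hpos
        linarith
      have hmaxW : IsMaxOn (fun y => W (t, y)) (Icc 1 r) x := isMaxOn_iff.2 fun y hy => by
        have h := isMaxOn_iff.1 hmax y hy
        have h' : exp (-(B * t)) * (1 + W (t, y)) ≤ exp (-(B * t)) * (1 + W (t, x)) := by
          linarith
        linarith [le_of_mul_le_mul_left h' (exp_pos _)]
      have hWslice : ∀ y ∈ Icc 1 r, HasDerivWithinAt (fun y => W (t, y))
          (fderivWithin ℝ W S (t, y) (0, 1)) (Icc 1 r) y := fun y hy =>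
        hasDerivWithinAt_slice_snd ht (hW.differentiableOn (by simp) (t, y) ⟨ht, hy⟩)
      have hW1slice := hasDerivWithinAt_slice_snd ht (hW1.differentiableOn (by simp) _ hz)
      have hFslice : HasDerivWithinAt (fun y => F (t, y)) (W (t, x)) (Icc 1 r) x :=
        hasDerivWithinAt_slice_snd ht (hF.differentiableOn (by simp) _ hz)
      obtain ⟨h1, h2, h3⟩ := weighted_conditions_of_isMaxOn hr hσ0 hσl hσr hx (hσ x hx)
        hWslice hW1slice hmaxW
      set q := fderivWithin ℝ W S (t, x) (0, 1) with hq
      set r' := fderivWithin ℝ (fun p => fderivWithin ℝ W S p (0, 1)) S (t, x) (0, 1) with hr'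
      have hΘxx : fderivWithin ℝ (fun p => fderivWithin ℝ Θ S p (0, 1)) S (t, x) (0, 1) =
          (r' * (1 + W (t, x) ^ 2) - q * (2 * W (t, x) * q)) / (1 + W (t, x) ^ 2) ^ 2 +
          (c * (W (t, x) + x * q - W (t, x)) * (x ^ 2 + F (t, x) ^ 2) -
            c * (x * W (t, x) - F (t, x)) * (2 * x + 2 * F (t, x) * W (t, x))) /
          (x ^ 2 + F (t, x) ^ 2) ^ 2 := by
        have hP : x ^ 2 + F (t, x) ^ 2 ≠ 0 := by
          have := hx.1
          positivity
        have hQ : 1 + W (t, x) ^ 2 ≠ 0 := by positivity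
        have e1 := hasDerivWithinAt_slice_snd ht (hΘ1.differentiableOn (by simp) _ hz)
        have hid := hasDerivWithinAt_id x (Icc 1 r)
        have e2 := (hW1slice.div (((hWslice x hx).pow 2).const_add 1) hQ).add
          ((((hid.mul (hWslice x hx)).sub hFslice).const_mul c).div
            ((hid.pow 2).add (hFslice.pow 2)) hP)
        rw [(uniqueDiffOn_Icc hr x hx).eq_deriv _ e1
          (e2.congr (fun y hy => hspace t ht y hy) (hspace t ht x hx))]
        simp only [id_eq, Pi.mul_apply, Pi.sub_apply, Pi.add_apply, Pi.pow_apply]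
        norm_num [hq]
      have hle := gradient_evolution_le hc hx.1 (hF0 _ hz) hWpos (hσ0 x hx) (hK₂ x hx)
        (hK₁ x hx) h1 h2 h3
      have hdt : fderivWithin ℝ W S (t, x) (1, 0) ≤ c * (K₁ + 2 * K₂) * (1 + W (t, x)) := by
        rw [hgrad t ht x hx, hΘxx, hspace t ht x hx]
        exact hle
      refine mul_neg_of_pos_of_neg (exp_pos _) ?_
      nlinarith [mul_lt_mul_of_pos_right hBK (by linarith : 0 < 1 + W (t, x))]
  intro t ht x hx
  have h := hmain t ht x hx
  have he : exp (-(B * t)) * exp (B * t) = 1 := by rw [← exp_add]; simp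
  calc 1 + W (t, x) = exp (-(B * t)) * (1 + W (t, x)) * exp (B * t) := by
        linear_combination -(1 + W (t, x)) * he
    _ ≤ M * exp (B * t) := mul_le_mul_of_nonneg_right (by linarith) (exp_pos _).le

/-- Supercritical phase forces positivity and a lower gradient bound. -/
lemma pos_and_neg_le_of_supercritical {c m x y w : ℝ} (hc : 2 ≤ c) (hx : 0 < x)
    (hm : (c - 1) * π / 2 < m) (hle : m ≤ c * arctan (y / x) + arctan w) :
    0 < y ∧ tan (m - c * (π / 2)) ≤ w := by
  have h1 := arctan_lt_pi_div_two w
  have h2 := arctan_lt_pi_div_two (y / x)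
  have hpi := pi_pos
  constructor
  · by_contra! hy
    have h3 : arctan (y / x) ≤ 0 := by
      rw [← arctan_zero]
      exact arctan_strictMono.monotone (div_nonpos_of_nonpos_of_nonneg hy hx.le)
    nlinarith
  · have h4 : m - c * (π / 2) ≤ arctan w := by nlinarith
    have h5 : -(π / 2) < m - c * (π / 2) := by linarith
    rw [← arctan_tan h5 (h4.trans_lt h1)] at h4
    exact arctan_strictMono.le_iff_le.1 h4

/-- A continuous function on a compact interval has a nonnegative upper bound. -/
lemma exists_upper_bound_Icc {l r : ℝ} {g : ℝ → ℝ} (hg : ContinuousOn g (Icc l r)) :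
    ∃ K : ℝ, 0 ≤ K ∧ ∀ x ∈ Icc l r, g x ≤ K := by
  obtain ⟨K, hK⟩ := isCompact_Icc.bddAbove_image hg
  exact ⟨max K 0, le_max_right _ _, fun x hx => (hK (mem_image_of_mem g hx)).trans (le_max_left _ _)⟩

/-- The reduced flow equation in divergence form `∂ₜ F = σ ∂ₓ Θ`. -/
lemma fderivWithin_time_eq_of_flow {n : ℕ} {a T : ℝ} (ha : 1 < a) {σ : ℝ → ℝ} {f : ℝ → ℝ → ℝ}
    (hf : ContDiffOn ℝ (⊤ : ℕ∞) (fun pt : ℝ × ℝ => f pt.1 pt.2) (Ico 0 T ×ˢ Icc 1 a))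
    (hflow : ∀ t ∈ Ico (0 : ℝ) T, ∀ x ∈ Icc 1 a,
      derivWithin (fun s => f s x) (Ico 0 T) t = flowRHS n a σ f t x) :
    ∀ p ∈ Ico 0 T ×ˢ Icc 1 a,
      fderivWithin ℝ (fun pt : ℝ × ℝ => f pt.1 pt.2) (Ico 0 T ×ˢ Icc 1 a) p (1, 0) =
      σ p.2 * fderivWithin ℝ (lagrangianAngle ((n : ℝ) - 1) (fun pt : ℝ × ℝ => f pt.1 pt.2)
        (Ico 0 T ×ˢ Icc 1 a)) (Ico 0 T ×ˢ Icc 1 a) p (0, 1) := by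
  rintro ⟨t, x⟩ ⟨ht, hx⟩
  have hx' : x ∈ Icc 1 a := hx
  have hS := uniqueDiffOn_Ico_prod_Icc T ha
  rw [fderivWithin_lagrangianAngle_space ha one_pos hf ht hx]
  have hz : (t, x) ∈ Ico 0 T ×ˢ Icc 1 a := ⟨ht, hx⟩
  have hW := contDiffOn_directional_fderivWithin hS hf (0, 1)
  have h1 : ∀ y ∈ Icc 1 a, derivWithin (f t) (Icc 1 a) y = fderivWithin ℝ
      (fun pt : ℝ × ℝ => f pt.1 pt.2) (Ico 0 T ×ˢ Icc 1 a) (t, y) (0, 1) := fun y hy =>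
    (hasDerivWithinAt_slice_snd (F := fun pt : ℝ × ℝ => f pt.1 pt.2) ht
      (hf.differentiableOn (by simp) (t, y) ⟨ht, hy⟩)).derivWithin (uniqueDiffOn_Icc ha y hy)
  have h2 := (hasDerivWithinAt_slice_snd ht (hW.differentiableOn (by simp) _ hz)).derivWithin
    (uniqueDiffOn_Icc ha x hx)
  have h3 := (hasDerivWithinAt_slice_fst (F := fun pt : ℝ × ℝ => f pt.1 pt.2) hx
    (hf.differentiableOn (by simp) (t, x) hz)).derivWithin (uniqueDiffOn_Ico 0 T t ht)
  rw [← h3, hflow t ht x hx, flowRHS, derivWithin_congr h1 (h1 x hx), h1 x hx, h2]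

/-- **Global gradient bound under supercritical phase** (Proposition 4.5).  For `n ≥ 3`,
`σ ≥ 0` smooth with `σ(1) = σ(a) = 0`, and supercritical initial data `f₀` with boundary
values `q`, `p`, any smooth solution of the reduced flow with fixed boundary values
satisfies `sup_x |∂ₓ f(t,x)| ≤ A(1+t)e^{Bt}` with `A, B` independent of `t` and `T`. -/
theorem global_gradient_bound (n : ℕ) (hn : 3 ≤ n) (a q p : ℝ) (ha : 1 < a)
    (σ : ℝ → ℝ) (hσ : ContDiffOn ℝ (⊤ : ℕ∞) σ (Icc 1 a))
    (hσ0 : ∀ x ∈ Icc 1 a, 0 ≤ σ x) (hσ1 : σ 1 = 0) (hσa : σ a = 0)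
    (f₀ : ℝ → ℝ)
    (hphase : ∀ x ∈ Icc 1 a,
      ((n : ℝ) - 1) * arctan (f₀ x / x) + arctan (derivWithin f₀ (Icc 1 a) x) >
        ((n : ℝ) - 2) * π / 2) :
    ∃ A B : ℝ, 0 < A ∧ 0 < B ∧
      ∀ T : ℝ, ∀ f : ℝ → ℝ → ℝ,
        ContDiffOn ℝ (⊤ : ℕ∞) (fun pt : ℝ × ℝ => f pt.1 pt.2) (Ico 0 T ×ˢ Icc 1 a) →
        (∀ x ∈ Icc 1 a, f 0 x = f₀ x) →
        (∀ t ∈ Ico (0 : ℝ) T, ∀ x ∈ Icc 1 a,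
          derivWithin (fun s => f s x) (Ico 0 T) t = flowRHS n a σ f t x) →
        (∀ t ∈ Ico (0 : ℝ) T, f t 1 = q ∧ f t a = p) →
        ∀ t ∈ Ico (0 : ℝ) T, ∀ x ∈ Icc 1 a,
          |derivWithin (f t) (Icc 1 a) x| ≤ A * (1 + t) * Real.exp (B * t) := by
  by_cases hf₀ : ContDiffOn ℝ (⊤ : ℕ∞) f₀ (Icc 1 a)
  swap
  · refine ⟨1, 1, one_pos, one_pos, fun T f hf hinit _ _ t ht => absurd ?_ hf₀⟩
    have h0 : (0 : ℝ) ∈ Ico 0 T := ⟨le_rfl, ht.1.trans_lt ht.2⟩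
    have hmaps : MapsTo (fun x : ℝ => ((0 : ℝ), x)) (Icc 1 a) (Ico 0 T ×ˢ Icc 1 a) :=
      fun x hx => ⟨h0, hx⟩
    exact (hf.comp (contDiffOn_const.prodMk contDiffOn_id) hmaps).congr
      fun x hx => (hinit x hx).symm
  have hJ := uniqueDiffOn_Icc ha
  have hσ' : ContinuousOn (derivWithin σ (Icc 1 a)) (Icc 1 a) :=
    hσ.continuousOn_derivWithin hJ (by simp)
  have hw₀ : ContinuousOn (derivWithin f₀ (Icc 1 a)) (Icc 1 a) :=
    hf₀.continuousOn_derivWithin hJ (by simp)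
  obtain ⟨K₁, hK₁0, hK₁⟩ := exists_upper_bound_Icc hσ'.abs
  obtain ⟨K₂, hK₂0, hK₂⟩ := exists_upper_bound_Icc hσ.continuousOn
  obtain ⟨W₀, hW₀0, hW₀⟩ := exists_upper_bound_Icc hw₀
  have hΘ₀ : ContinuousOn (fun x => ((n : ℝ) - 1) * arctan (f₀ x / x) +
      arctan (derivWithin f₀ (Icc 1 a) x)) (Icc 1 a) :=
    (continuousOn_const.mul (continuous_arctan.comp_continuousOn
      (hf₀.continuousOn.div continuousOn_id fun x hx => (one_pos.trans_le hx.1).ne'))).add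
      (continuous_arctan.comp_continuousOn hw₀)
  obtain ⟨x₀, hx₀, hmin⟩ := isCompact_Icc.exists_isMinOn (nonempty_Icc.2 ha.le) hΘ₀
  set m := ((n : ℝ) - 1) * arctan (f₀ x₀ / x₀) + arctan (derivWithin f₀ (Icc 1 a) x₀) with hm
  have hc : (2 : ℝ) ≤ (n : ℝ) - 1 := by
    have : (3 : ℝ) ≤ n := by exact_mod_cast hn
    linarith
  have hcrit : ((n : ℝ) - 1 - 1) * π / 2 < m := by
    have h := hphase x₀ hx₀
    rwa [sub_sub, one_add_one_eq_two]
  set L := |tan (m - ((n : ℝ) - 1) * (π / 2))| with hL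
  have hL0 : 0 ≤ L := abs_nonneg _
  have hCK : 0 ≤ ((n : ℝ) - 1) * (K₁ + 2 * K₂) := mul_nonneg (by linarith) (by linarith)
  refine ⟨1 + W₀ + L, ((n : ℝ) - 1) * (K₁ + 2 * K₂) + 1, by linarith, by linarith, ?_⟩
  intro T f hf hinit hflow _ t ht x hx
  have h0 : (0 : ℝ) ∈ Ico 0 T := ⟨le_rfl, ht.1.trans_lt ht.2⟩
  have hpde := fderivWithin_time_eq_of_flow ha hf hflow
  have hslice : ∀ s ∈ Ico 0 T, ∀ y ∈ Icc 1 a, derivWithin (f s) (Icc 1 a) y = fderivWithin ℝ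
      (fun pt : ℝ × ℝ => f pt.1 pt.2) (Ico 0 T ×ˢ Icc 1 a) (s, y) (0, 1) := fun s hs y hy =>
    (hasDerivWithinAt_slice_snd (F := fun pt : ℝ × ℝ => f pt.1 pt.2) hs
      (hf.differentiableOn (by simp) (s, y) ⟨hs, hy⟩)).derivWithin (hJ y hy)
  have hw_init : ∀ y ∈ Icc 1 a, fderivWithin ℝ (fun pt : ℝ × ℝ => f pt.1 pt.2)
      (Ico 0 T ×ˢ Icc 1 a) (0, y) (0, 1) = derivWithin f₀ (Icc 1 a) y := fun y hy => by
    rw [← hslice 0 h0 y hy, derivWithin_congr hinit (hinit y hy)]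
  have hσd : ∀ y ∈ Icc 1 a, HasDerivWithinAt σ (derivWithin σ (Icc 1 a) y) (Icc 1 a) y :=
    fun y hy => (hσ.differentiableOn (by simp) y hy).hasDerivWithinAt
  have hangle := le_lagrangianAngle_of_initial (m := m) ha one_pos hσd hσ0 hσ1 hσa hf hpde
    fun y hy => by
      simp only [lagrangianAngle, hw_init y hy, hinit y hy]
      exact isMinOn_iff.1 hmin y hy
  have hsuper : ∀ s ∈ Ico 0 T, ∀ y ∈ Icc 1 a, 0 < f s y ∧
      tan (m - ((n : ℝ) - 1) * (π / 2)) ≤ derivWithin (f s) (Icc 1 a) y := fun s hs y hy => by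
    refine pos_and_neg_le_of_supercritical hc (one_pos.trans_le hy.1) hcrit ?_
    rw [hslice s hs y hy]
    exact hangle s hs y hy
  have hupper := gradient_le_of_initial (M := 1 + W₀) (by linarith) ha hσd hσ0 hσ1 hσa hK₁ hK₂
    hf hpde (fun p hp => (hsuper p.1 hp.1 p.2 hp.2).1.le) (by linarith)
    (B := ((n : ℝ) - 1) * (K₁ + 2 * K₂) + 1) (by linarith) (by linarith)
    (fun y hy => by rw [hw_init y hy]; linarith [hW₀ y hy]) t ht x hx
  rw [← hslice t ht x hx] at hupper
  have hlower := (hsuper t ht x hx).2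
  set E := exp ((((n : ℝ) - 1) * (K₁ + 2 * K₂) + 1) * t) with hE
  have hE1 : 1 ≤ E := one_le_exp (mul_nonneg (by linarith) ht.1)
  have hA : (1 + W₀ + L) * E ≤ (1 + W₀ + L) * (1 + t) * E := by
    have := mul_nonneg (mul_nonneg (by linarith : 0 ≤ 1 + W₀ + L) ht.1) (by linarith : 0 ≤ E)
    nlinarith
  refine le_trans (abs_le.2 ⟨?_, ?_⟩) hA
  · have h1 : -L ≤ tan (m - ((n : ℝ) - 1) * (π / 2)) := neg_abs_le _
    nlinarith
  · nlinarith
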